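/- Let Λ be a ring that is left noetherian and right noetherian. Then for every nonnegative integer n, every right Λ-module has projective dimension at most n if and only if every left Λ-module has projective dimension at most n; that is, the global dimension of the category of all right Λ-modules equals the global dimension of the category of all left Λ-modules. -/

import Mathlib

/-!
STATEMENT 8: Let `Λ` be a ring that is left noetherian and right noetherian.  Then for
every nonnegative integer `n`, every right `Λ`-module has projective dimension at most
`n` if and only if every left `Λ`-module has projective dimension at most `n`; that is,
the global dimension of the category of all right `Λ`-modules equals the global
dimension of the category of all left `Λ`-modules.

Right `Λ`-modules are encoded as (left) `Λᵐᵒᵖ`-modules, so `Λ` being right noetherian is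
`IsNoetherianRing Λᵐᵒᵖ`.  "Projective dimension at most `n`" is expressed by the
existence of a projective resolution `0 → Pₙ → ⋯ → P₀ → M → 0`, i.e. a projective
resolution whose terms vanish in degrees `> n`.
-/

open CategoryTheory

universe u

/-- `M` has projective dimension at most `n`: it admits a projective resolution
vanishing in degrees greater than `n`, i.e. one of the form `0 → Pₙ → ⋯ → P₀ → M → 0`. -/
def ProjDimLE {R : Type u} [Ring R] (M : ModuleCat.{u} R) (n : ℕ) : Prop :=
  ∃ P : ProjectiveResolution M, ∀ i, n < i → Limits.IsZero (P.complex.X i)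

/-- The projective dimension of a module, as an element of `ℕ∞` (equal to `⊤` if the
module has no finite projective resolution). -/
noncomputable def projDim {R : Type u} [Ring R] (M : ModuleCat.{u} R) : ℕ∞ :=
  sInf {d : ℕ∞ | ∃ n : ℕ, d = n ∧ ProjDimLE M n}

/-- The global dimension of the category of all `R`-modules: the supremum of the
projective dimensions of all `R`-modules. -/
noncomputable def globalDim (R : Type u) [Ring R] : ℕ∞ :=
  ⨆ M : ModuleCat.{u} R, projDim M

section Dimension

open Abelian Limits

variable {R : Type u} [Ring R]

/-- Splicing a projective resolution of the kernel term of a short exact sequence with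
projective middle term gives a projective resolution of the cokernel term. -/
theorem ProjDimLE.of_shortExact {S : ShortComplex (ModuleCat.{u} R)} (hS : S.ShortExact)
    [Projective S.X₂] {n : ℕ} (h : ProjDimLE S.X₁ n) : ProjDimLE S.X₃ (n + 1) := by
  obtain ⟨P, hP⟩ := h
  have := hS.mono_f
  have := hS.epi_g
  let p : P.complex.X 0 ⟶ S.X₁ := P.π.f 0
  have hp : P.complex.d 1 0 ≫ p = 0 := P.complex_d_comp_π_f_zero
  have hp_epi : Epi p := inferInstanceAs (Epi (P.π.f 0))
  have w : P.complex.d 1 0 ≫ p ≫ S.f = 0 := by rw [reassoc_of% hp, zero_comp]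
  have w' : (p ≫ S.f) ≫ S.g = 0 := by rw [Category.assoc, S.zero, comp_zero]
  let C := ChainComplex.augment P.complex (p ≫ S.f) w
  have exact_zero : (ShortComplex.mk (p ≫ S.f) S.g w').Exact := by
    let α : ShortComplex.mk (p ≫ S.f) S.g w' ⟶ S :=
      { τ₁ := p
        τ₂ := 𝟙 _
        τ₃ := 𝟙 _ }
    have : Epi α.τ₁ := hp_epi
    have : IsIso α.τ₂ := inferInstanceAs (IsIso (𝟙 _))
    have : Mono α.τ₃ := inferInstanceAs (Mono (𝟙 _))
    exact (ShortComplex.exact_iff_of_epi_of_isIso_of_mono α).2 hS.exact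
  have exact_one : (ShortComplex.mk (P.complex.d 1 0) (p ≫ S.f) w).Exact := by
    let α : ShortComplex.mk (P.complex.d 1 0) p hp ⟶
        ShortComplex.mk (P.complex.d 1 0) (p ≫ S.f) w :=
      { τ₁ := 𝟙 _
        τ₂ := 𝟙 _
        τ₃ := S.f }
    have : Epi α.τ₁ := inferInstanceAs (Epi (𝟙 _))
    have : IsIso α.τ₂ := inferInstanceAs (IsIso (𝟙 _))
    have : Mono α.τ₃ := inferInstanceAs (Mono S.f)
    exact (ShortComplex.exact_iff_of_epi_of_isIso_of_mono α).1
      (ShortComplex.exact_of_g_is_cokernel _ P.isColimitCokernelCofork)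
  have exact_succ (i : ℕ) : C.ExactAt (i + 1) := by
    rw [HomologicalComplex.exactAt_iff' _ (i + 1 + 1) (i + 1) i (by simp) (by simp)]
    match i with
    | 0 => exact exact_one
    | i + 1 => exact P.exact_succ i
  refine ⟨{ complex := C
            projective := ?_
            π := (ChainComplex.toSingle₀Equiv C S.X₃).symm ⟨S.g, w'⟩
            quasiIso := ⟨fun i => ?_⟩ }, ?_⟩
  · rintro (_ | i)
    · assumption
    · exact P.projective i
  · cases i with
    | zero =>
      rw [ChainComplex.quasiIsoAt₀_iff, ShortComplex.quasiIso_iff_of_zeros']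
      · refine (ShortComplex.exact_and_epi_g_iff_of_iso ?_).2 ⟨exact_zero, this⟩
        exact ShortComplex.isoMk (Iso.refl _) (Iso.refl _) (Iso.refl _) (by simp; rfl)
          ((Category.id_comp _).trans (Category.comp_id _).symm)
      all_goals rfl
    | succ i =>
      rw [quasiIsoAt_iff_exactAt' _ _ (ChainComplex.exactAt_succ_single_obj _ _)]
      exact exact_succ i
  · rintro (_ | i) hi
    · omega
    · exact hP i (by omega)

theorem projDimLE_iff_hasProjectiveDimensionLE (M : ModuleCat.{u} R) (n : ℕ) :
    ProjDimLE M n ↔ HasProjectiveDimensionLE M n := by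
  refine ⟨fun ⟨P, hP⟩ => HasProjectiveDimensionLT.mk fun i hi Y e => ?_, fun h => ?_⟩
  · obtain ⟨f, hf, rfl⟩ := P.extMk_surjective e (i + 1) rfl
    obtain rfl : f = 0 := (hP i hi).eq_of_src _ _
    simp
  · induction n generalizing M with
    | zero =>
      have := (projective_iff_hasProjectiveDimensionLE_zero M).2 h
      refine ⟨ProjectiveResolution.self M, fun i hi => ?_⟩
      exact HomologicalComplex.isZero_single_obj_X _ _ _ _ (by omega)
    | succ n ih =>
      have hS := M.shortExact_projectiveShortComplex
      have : Projective M.projectiveShortComplex.X₂ := inferInstance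
      exact .of_shortExact hS
        (ih _ ((hS.hasProjectiveDimensionLT_X₃_iff n inferInstance).1 h))

theorem projDim_le_iff (M : ModuleCat.{u} R) (n : ℕ) : projDim M ≤ n ↔ ProjDimLE M n := by
  refine ⟨fun h => ?_, fun h => sInf_le ⟨n, rfl, h⟩⟩
  have hne : {d : ℕ∞ | ∃ n : ℕ, d = n ∧ ProjDimLE M n}.Nonempty := by
    by_contra hempty
    rw [Set.not_nonempty_iff_eq_empty] at hempty
    simp [projDim, hempty] at h
  obtain ⟨m, hm, hM⟩ := csInf_mem hne
  rw [projDim, hm, Nat.cast_le] at h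
  rw [projDimLE_iff_hasProjectiveDimensionLE] at hM ⊢
  exact hasProjectiveDimensionLT_of_ge M (m + 1) (n + 1) (by omega)

theorem globalDim_le_iff (n : ℕ) :
    globalDim R ≤ n ↔ ∀ M : ModuleCat.{u} R, ProjDimLE M n := by
  simp [globalDim, projDim_le_iff]

/-- A dimension-shifted form of Baer's criterion. -/
theorem hasInjectiveDimensionLE_of_subsingleton_ext (n : ℕ) (N : ModuleCat.{u} R)
    (h : ∀ I : Ideal R, Subsingleton (Ext (ModuleCat.of R (R ⧸ I)) N (n + 1))) :
    HasInjectiveDimensionLE N n := by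
  induction n generalizing N with
  | zero =>
    suffices Module.Baer R N by
      have := this.injective
      have : Injective (ModuleCat.of R N) :=
        Module.injective_object_of_injective_module R N
      exact injective_iff_hasInjectiveDimensionLT_one.1 this
    intro I g
    have hS := ModuleCat.shortComplex_shortExact
      (ModuleCat.shortComplexOfCompEqZero I.subtype I.mkQ (by ext; simp))
      (LinearMap.exact_subtype_mkQ I) I.injective_subtype I.mkQ_surjective
    obtain ⟨x, hx⟩ := Ext.contravariant_sequence_exact₁ hS N
      (Ext.mk₀ (ModuleCat.ofHom g)) (add_zero 1) ((h I).elim _ _)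
    obtain ⟨φ, rfl⟩ := Ext.homEquiv₀.symm.surjective x
    have hφ : ModuleCat.ofHom I.subtype ≫ φ = ModuleCat.ofHom g :=
      Ext.homEquiv₀.symm.injective (by simpa using hx)
    refine ⟨φ.hom, fun x hx => ?_⟩
    exact congr($(hφ).hom ⟨x, hx⟩)
  | succ n ih =>
    let S := ShortComplex.mk (Injective.ι N) (cokernel.π (Injective.ι N))
      (cokernel.condition _)
    have hS : S.ShortExact := { exact := ShortComplex.exact_cokernel _ }
    refine (hS.hasInjectiveDimensionLT_X₃_iff n (inferInstanceAs
      (Injective (Injective.under N)))).1 (ih _ fun I => subsingleton_of_forall_eq 0 fun x => ?_)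
    obtain ⟨y, rfl⟩ := Ext.covariant_sequence_exact₃ _ hS x rfl ((h I).elim _ _)
    have : Injective S.X₂ := inferInstanceAs (Injective (Injective.under N))
    rw [Ext.eq_zero_of_injective y, Ext.zero_comp]

/-- The global dimension is the supremum of the projective dimensions of cyclic modules. -/
theorem hasProjectiveDimensionLE_of_forall_ideal (n : ℕ)
    (h : ∀ I : Ideal R, HasProjectiveDimensionLE (ModuleCat.of R (R ⧸ I)) n)
    (M : ModuleCat.{u} R) : HasProjectiveDimensionLE M n :=
  HasProjectiveDimensionLT.mk fun _ hi Y e =>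
    have := hasInjectiveDimensionLE_of_subsingleton_ext n Y fun I =>
      (h I).subsingleton _ _ _ le_rfl _
    e.eq_zero_of_hasInjectiveDimensionLT (n + 1) hi

end Dimension

section RowAction

variable {S : Type u} [Ring S] {l m n : ℕ}

/-- The action `v ↦ v * A` of a matrix on row vectors with entries in a right module. -/
def rowAct {N : Type u} [AddCommGroup N] [Module Sᵐᵒᵖ N] (A : Matrix (Fin m) (Fin n) S) :
    (Fin m → N) →+ (Fin n → N) where
  toFun v j := ∑ i, MulOpposite.op (A i j) • v i
  map_zero' := by ext; simp
  map_add' v w := by ext; simp [Finset.sum_add_distrib]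

variable {N N' : Type u} [AddCommGroup N] [Module Sᵐᵒᵖ N] [AddCommGroup N'] [Module Sᵐᵒᵖ N']

theorem rowAct_apply (A : Matrix (Fin m) (Fin n) S) (v : Fin m → N) (j : Fin n) :
    rowAct A v j = ∑ i, MulOpposite.op (A i j) • v i := rfl

theorem rowAct_mul (A : Matrix (Fin l) (Fin m) S) (B : Matrix (Fin m) (Fin n) S)
    (v : Fin l → N) : rowAct (A * B) v = rowAct B (rowAct A v) := by
  ext j
  simp only [rowAct_apply, Matrix.mul_apply, Finset.op_sum, MulOpposite.op_mul,
    Finset.sum_smul, Finset.smul_sum, mul_smul]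
  exact Finset.sum_comm

theorem rowAct_map (f : N →ₗ[Sᵐᵒᵖ] N') (A : Matrix (Fin m) (Fin n) S) (v : Fin m → N) :
    rowAct A (f ∘ v) = f ∘ rowAct A v := by
  ext j
  simp [rowAct_apply]

/-- Two consecutive matrices are exact on row vectors with entries in the right module `N`. -/
def RowExact (N : Type u) [AddCommGroup N] [Module Sᵐᵒᵖ N] (A : Matrix (Fin l) (Fin m) S)
    (B : Matrix (Fin m) (Fin n) S) : Prop :=
  ∀ v : Fin m → N, rowAct B v = 0 → ∃ w, rowAct A w = v

variable {A : Matrix (Fin l) (Fin m) S} {B : Matrix (Fin m) (Fin n) S}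

theorem RowExact.finsupp (h : ∀ v, Matrix.vecMul v B = 0 → ∃ w, Matrix.vecMul w A = v)
    (X : Type u) : RowExact (X →₀ Sᵐᵒᵖ) A B := by
  classical
  intro v hv
  have key (x : X) : ∃ w : Fin l → S, Matrix.vecMul w A = (fun i => (v i x).unop) ∧
      ((∀ i, v i x = 0) → w = 0) := by
    by_cases hx : ∀ i, v i x = 0
    · exact ⟨0, by ext; simp [hx], fun _ => rfl⟩
    · obtain ⟨w, hw⟩ := h (fun i => (v i x).unop) (by
        ext j
        have := congr(($(congrFun hv j) x).unop)
        simpa [rowAct_apply, Matrix.vecMul, dotProduct, Finsupp.finsetSum_apply] using this)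
      exact ⟨w, hw, fun h => absurd h hx⟩
  choose W hW hW0 using key
  refine ⟨fun i => Finsupp.onFinset (Finset.univ.biUnion fun i => (v i).support)
    (fun x => MulOpposite.op (W x i)) fun x hx => ?_, ?_⟩
  · by_contra hmem
    exact hx (by simp [hW0 x (by simpa using hmem)])
  · ext j x
    have := congrFun (hW x) j
    simp only [Matrix.vecMul, dotProduct] at this
    apply MulOpposite.unop_injective
    simpa [rowAct_apply, Finsupp.finsetSum_apply] using this

theorem RowExact.of_retract (h : RowExact N' A B) (i : N →ₗ[Sᵐᵒᵖ] N') (r : N' →ₗ[Sᵐᵒᵖ] N)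
    (hir : r ∘ₗ i = LinearMap.id) : RowExact N A B := by
  intro v hv
  obtain ⟨w, hw⟩ := h (i ∘ v) (by rw [rowAct_map, hv]; ext; simp)
  refine ⟨r ∘ w, ?_⟩
  rw [rowAct_map, hw, ← Function.comp_assoc, ← LinearMap.coe_comp, hir]
  rfl

theorem RowExact.of_projective (h : ∀ v, Matrix.vecMul v B = 0 → ∃ w, Matrix.vecMul w A = v)
    [Module.Projective Sᵐᵒᵖ N] : RowExact N A B := by
  obtain ⟨s, hs⟩ := Module.projective_def'.1 ‹Module.Projective Sᵐᵒᵖ N›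
  exact (RowExact.finsupp h N).of_retract s _ hs

/-- Exactness of a complex of matrices at a cokernel term, from exactness one step earlier at
the kernel term and exactness at the middle term of a short exact sequence. -/
theorem RowExact.of_shortExact {k : ℕ} {C : Matrix (Fin n) (Fin k) S} {K P : Type u}
    [AddCommGroup K] [Module Sᵐᵒᵖ K] [AddCommGroup P] [Module Sᵐᵒᵖ P]
    {f : K →ₗ[Sᵐᵒᵖ] P} {g : P →ₗ[Sᵐᵒᵖ] N} (hf : Function.Injective f)
    (hfg : Function.Exact f g) (hg : Function.Surjective g) (hBC : B * C = 0)
    (hK : RowExact K B C) (hP : RowExact P A B) : RowExact N A B := by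
  intro v hv
  obtain ⟨u, rfl⟩ : ∃ u, g ∘ u = v := ⟨_, funext fun i => (hg (v i)).choose_spec⟩
  rw [rowAct_map] at hv
  choose x hx using fun j => (hfg _).1 (congrFun hv j)
  have hx' : f ∘ x = rowAct B u := funext hx
  obtain ⟨y, rfl⟩ := hK x (by
    apply hf.comp_left
    change f ∘ rowAct C x = f ∘ (0 : Fin k → K)
    rw [← rowAct_map, hx', ← rowAct_mul, hBC]
    ext; simp [rowAct_apply])
  rw [← rowAct_map] at hx'
  obtain ⟨w, hw⟩ := hP (u - f ∘ y) (by rw [map_sub, hx', sub_self])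
  refine ⟨g ∘ w, ?_⟩
  rw [rowAct_map, hw]
  ext i
  simp [hfg.apply_apply_eq_zero]

/-- If a composable pair of matrices `A`, `B` with product zero is exact on row vectors with
entries in every right module, then `B` is von Neumann regular. -/
theorem exists_mul_mul_eq_of_rowExact (hAB : A * B = 0)
    (h : ∀ (T : Type u) [AddCommGroup T] [Module Sᵐᵒᵖ T], RowExact T A B) :
    ∃ X : Matrix (Fin n) (Fin m) S, B * X * B = B := by
  let Q : Submodule Sᵐᵒᵖ (Fin m → S) := Submodule.span Sᵐᵒᵖ (Set.range B.col)
  let t : Fin m → (Fin m → S) ⧸ Q := fun i => Q.mkQ (Pi.single i 1)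
  obtain ⟨w, hw⟩ := h _ t (by
    ext j
    have hcol : B.col j = ∑ i, MulOpposite.op (B i j) • (Pi.single i 1 : Fin m → S) := by
      ext i
      simp [Finset.sum_apply, Pi.single_apply]
    simp only [rowAct_apply, t, ← map_smul, ← map_sum, ← hcol]
    simpa using Submodule.subset_span (Set.mem_range_self j))
  choose z hz using fun a => Q.mkQ_surjective (w a)
  have hmem (i : Fin m) : Pi.single i 1 - ∑ a, MulOpposite.op (A a i) • z a ∈ Q := by
    have := congrFun hw i
    simp only [rowAct_apply, ← hz, ← map_smul, ← map_sum, t] at this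
    exact (Submodule.Quotient.eq Q).1 this.symm
  choose c hc using fun i => (Submodule.mem_span_range_iff_exists_fun Sᵐᵒᵖ).1 (hmem i)
  let X : Matrix (Fin n) (Fin m) S := .of fun j i => (c i j).unop
  let Z : Matrix (Fin m) (Fin l) S := .of fun i a => z a i
  have hone : B * X = 1 - Z * A := by
    ext i j
    have := congrFun (hc j) i
    simpa [Matrix.mul_apply, Finset.sum_apply, X, Z, Matrix.one_apply, Pi.single_apply]
      using this
  exact ⟨X, by rw [hone, Matrix.sub_mul, Matrix.mul_assoc, hAB, Matrix.mul_zero, sub_zero,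
    Matrix.one_mul]⟩

end RowAction

section FreeResolution

variable {S : Type u} [Ring S]

theorem projective_quotient_range_of_mul_mul_eq {m n : ℕ} {B : Matrix (Fin m) (Fin n) S}
    {X : Matrix (Fin n) (Fin m) S} (h : B * X * B = B) :
    Module.Projective S ((Fin n → S) ⧸ LinearMap.range B.vecMulLinear) := by
  refine .of_split (Submodule.liftQ _ (LinearMap.id - (X * B).vecMulLinear) ?_)
    (Submodule.mkQ _) ?_
  · rintro _ ⟨v, rfl⟩
    simp [← Matrix.mul_assoc, h]
  · ext i
    simp only [LinearMap.coe_comp, Function.comp_apply, Submodule.mkQ_apply,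
      Submodule.liftQ_apply, LinearMap.id_apply, LinearMap.sub_apply, Submodule.Quotient.mk_sub,
      sub_eq_self, Submodule.Quotient.mk_eq_zero]
    refine ⟨X.row i, ?_⟩
    change Matrix.vecMul (X.row i) B = Matrix.vecMul (Pi.single i 1) (X * B)
    rw [Matrix.single_one_vecMul]
    rfl

/-- The kernel of a map from a finite free module is the row space of a matrix. -/
theorem exists_matrix_range_eq_ker [IsNoetherianRing S] {M : Type u} [AddCommGroup M]
    [Module S M] {n : ℕ} (f : (Fin n → S) →ₗ[S] M) :
    ∃ (m : ℕ) (A : Matrix (Fin m) (Fin n) S),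
      LinearMap.range A.vecMulLinear = LinearMap.ker f := by
  obtain ⟨m, s, hs⟩ := Submodule.fg_iff_exists_fin_generating_family.1
    (IsNoetherian.noetherian (LinearMap.ker f))
  refine ⟨m, .of s, ?_⟩
  rw [← hs, ← Fintype.range_linearCombination]
  congr 1
  ext
  simp

/-- A finitely generated module over a noetherian ring has a resolution by finitely generated
free modules, given by a sequence of matrices acting on row vectors. -/
theorem exists_matrix_resolution [IsNoetherianRing S] (M : Type u) [AddCommGroup M]
    [Module S M] [Module.Finite S M] :
    ∃ (k : ℕ → ℕ) (A : ∀ i, Matrix (Fin (k (i + 1))) (Fin (k i)) S),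
      Nonempty (((Fin (k 0) → S) ⧸ LinearMap.range (A 0).vecMulLinear) ≃ₗ[S] M) ∧
      ∀ i, LinearMap.range (A (i + 1)).vecMulLinear = LinearMap.ker (A i).vecMulLinear := by
  obtain ⟨n, f, hf⟩ := Module.Finite.exists_fin' S M
  obtain ⟨m, A₀, hA₀⟩ := exists_matrix_range_eq_ker f
  choose r A hA using fun p : Σ m n, Matrix (Fin m) (Fin n) S =>
    exists_matrix_range_eq_ker p.2.2.vecMulLinear
  let s (i : ℕ) : Σ m n, Matrix (Fin m) (Fin n) S :=
    Nat.rec ⟨m, n, A₀⟩ (fun _ p => ⟨r p, p.1, A p⟩) i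
  exact ⟨fun i => (s i).2.1, fun i => (s i).2.2,
    ⟨(Submodule.quotEquivOfEq _ _ hA₀).trans (f.quotKerEquivOfSurjective hf)⟩,
    fun i => hA (s i)⟩

variable {k : ℕ → ℕ} {A : ∀ i, Matrix (Fin (k (i + 1))) (Fin (k i)) S}

theorem mul_eq_zero_of_range_eq_ker {l m n : ℕ} {A : Matrix (Fin l) (Fin m) S}
    {B : Matrix (Fin m) (Fin n) S}
    (h : LinearMap.range A.vecMulLinear = LinearMap.ker B.vecMulLinear) : A * B = 0 := by
  ext i j
  have : Matrix.vecMul (Matrix.vecMul (Pi.single i 1) A) B = 0 :=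
    h.le (LinearMap.mem_range_self A.vecMulLinear (Pi.single i 1))
  rw [Matrix.vecMul_vecMul] at this
  simpa using congrFun this j

theorem rowExact_of_hasProjectiveDimensionLE
    (hA : ∀ i, LinearMap.range (A (i + 1)).vecMulLinear = LinearMap.ker (A i).vecMulLinear)
    (d : ℕ) (N : ModuleCat.{u} Sᵐᵒᵖ) (hN : HasProjectiveDimensionLE N d) (i : ℕ) (hi : d ≤ i) :
    RowExact N (A (i + 1)) (A i) := by
  have exact_self (j : ℕ) (v : Fin (k (j + 1)) → S) (hv : Matrix.vecMul v (A j) = 0) :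
      ∃ w, Matrix.vecMul w (A (j + 1)) = v := (hA j).ge hv
  induction d generalizing N i with
  | zero =>
    have := (projective_iff_hasProjectiveDimensionLE_zero N).2 hN
    have := N.projective_of_module_projective
    exact .of_projective (exact_self i)
  | succ d ih =>
    obtain ⟨i, rfl⟩ : ∃ j, i = j + 1 := ⟨i - 1, by omega⟩
    have hS := N.shortExact_projectiveShortComplex
    refine .of_shortExact hS.moduleCat_injective_f
      ((ShortComplex.ShortExact.moduleCat_exact_iff_function_exact _).1 hS.exact)
      hS.moduleCat_surjective_g (mul_eq_zero_of_range_eq_ker (hA i))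
      (ih _ ((hS.hasProjectiveDimensionLT_X₃_iff d inferInstance).1 hN) i (by omega))
      (.of_projective (exact_self (i + 1)))

theorem hasProjectiveDimensionLE_quotient_range_succ
    (hA : ∀ i, LinearMap.range (A (i + 1)).vecMulLinear = LinearMap.ker (A i).vecMulLinear)
    (d i : ℕ) (h : HasProjectiveDimensionLE
      (ModuleCat.of S ((Fin (k (i + 1)) → S) ⧸ LinearMap.range (A (i + 1)).vecMulLinear)) d) :
    HasProjectiveDimensionLE
      (ModuleCat.of S ((Fin (k i) → S) ⧸ LinearMap.range (A i).vecMulLinear)) (d + 1) := by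
  let f := Submodule.liftQ _ (A i).vecMulLinear (hA i).le
  have hrange : LinearMap.range f = LinearMap.range (A i).vecMulLinear :=
    Submodule.range_liftQ _ _ _
  have hinj : Function.Injective f :=
    LinearMap.ker_eq_bot.1 (Submodule.ker_liftQ_eq_bot _ _ _ (hA i).ge)
  have hex : Function.Exact f (LinearMap.range (A i).vecMulLinear).mkQ := by
    rw [LinearMap.exact_iff, Submodule.ker_mkQ, hrange]
  have hS := ModuleCat.shortComplex_shortExact
    (ModuleCat.shortComplexOfCompEqZero f _ hex.linearMap_comp_eq_zero) hex hinj
    (Submodule.mkQ_surjective _)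
  exact (hS.hasProjectiveDimensionLT_X₃_iff d
    (ModuleCat.projective_of_categoryTheory_projective _)).2 h

/-- If all right modules have projective dimension at most `n`, then so do the finitely
generated left modules over a left noetherian ring. -/
theorem hasProjectiveDimensionLE_of_finite [IsNoetherianRing S] (n : ℕ)
    (h : ∀ N : ModuleCat.{u} Sᵐᵒᵖ, HasProjectiveDimensionLE N n)
    (M : ModuleCat.{u} S) [Module.Finite S M] : HasProjectiveDimensionLE M n := by
  obtain ⟨k, A, ⟨e⟩, hA⟩ := exists_matrix_resolution M (S := S)
  obtain ⟨X, hX⟩ := exists_mul_mul_eq_of_rowExact (mul_eq_zero_of_range_eq_ker (hA n))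
    fun T _ _ => rowExact_of_hasProjectiveDimensionLE hA n (ModuleCat.of Sᵐᵒᵖ T) (h _) n le_rfl
  have := projective_quotient_range_of_mul_mul_eq hX
  have key (d i : ℕ) (hdi : d + i = n) : HasProjectiveDimensionLE
      (ModuleCat.of S ((Fin (k i) → S) ⧸ LinearMap.range (A i).vecMulLinear)) d := by
    induction d generalizing i with
    | zero =>
      obtain rfl : i = n := by omega
      exact (projective_iff_hasProjectiveDimensionLE_zero _).1
        (ModuleCat.projective_of_categoryTheory_projective _)
    | succ d ih => exact hasProjectiveDimensionLE_quotient_range_succ hA d i (ih _ (by omega))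
  have := key n 0 rfl
  exact hasProjectiveDimensionLT_of_iso e.toModuleIso (n + 1)

end FreeResolution

theorem projDimLE_of_forall_mulOpposite {S : Type u} [Ring S] [IsNoetherianRing S] {n : ℕ}
    (h : ∀ N : ModuleCat.{u} Sᵐᵒᵖ, ProjDimLE N n) (M : ModuleCat.{u} S) : ProjDimLE M n := by
  simp only [projDimLE_iff_hasProjectiveDimensionLE] at h ⊢
  exact hasProjectiveDimensionLE_of_forall_ideal n
    (fun I => hasProjectiveDimensionLE_of_finite n h _) M

theorem projDimLE_of_ringEquiv {R S : Type u} [Ring R] [Ring S] (e : R ≃+* S) {n : ℕ}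
    (h : ∀ M : ModuleCat.{u} R, ProjDimLE M n) (N : ModuleCat.{u} S) : ProjDimLE N n := by
  simp only [projDimLE_iff_hasProjectiveDimensionLE] at h ⊢
  let := Module.compHom N (e : R →+* S)
  have := h (ModuleCat.of R N)
  have := RingHomInvPair.of_ringEquiv e
  have := RingHomInvPair.of_ringEquiv e.symm
  exact ModuleCat.hasProjectiveDimensionLE_of_semiLinearEquiv e
    (M := ModuleCat.of R N)
    { AddEquiv.refl N with map_smul' := fun _ _ => rfl } n

theorem globalDim_eq_of_noetherian (Λ : Type u) [Ring Λ]
    [IsNoetherianRing Λ] [IsNoetherianRing Λᵐᵒᵖ] :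
    (∀ n : ℕ,
      (∀ M : ModuleCat.{u} Λᵐᵒᵖ, ProjDimLE M n) ↔ (∀ M : ModuleCat.{u} Λ, ProjDimLE M n)) ∧
    globalDim Λᵐᵒᵖ = globalDim Λ := by
  have h (n : ℕ) : (∀ M : ModuleCat.{u} Λᵐᵒᵖ, ProjDimLE M n) ↔
      (∀ M : ModuleCat.{u} Λ, ProjDimLE M n) :=
    ⟨projDimLE_of_forall_mulOpposite, fun h =>
      projDimLE_of_forall_mulOpposite (projDimLE_of_ringEquiv (RingEquiv.opOp Λ) h)⟩
  refine ⟨h, eq_of_forall_ge_iff fun c => ?_⟩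
  induction c with
  | top => simp
  | coe n => rw [globalDim_le_iff, globalDim_le_iff, h]
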